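/- Suppose α is a silhouette curve with axis d (i.e. d is a unit vector with ⟪N(s), d⟫ = 0 for all s) and k_n(s)² + τ_g(s)² > 0 for all s. Then there exists ε ∈ {1, −1} such that for all s, √(k_n(s)² + τ_g(s)²) · d = ε·(τ_g(s)·T(s) − k_n(s)·B(s)); in particular, for every s the axis d lies in the plane spanned by T(s) and B(s). -/

import Mathlib

open scoped RealInnerProductSpace

noncomputable section

/-- The cross product on `EuclideanSpace ℝ (Fin 3)`. -/
def cross3 (u v : EuclideanSpace ℝ (Fin 3)) : EuclideanSpace ℝ (Fin 3) :=
  (EuclideanSpace.equiv (Fin 3) ℝ).symm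
    (crossProduct ((EuclideanSpace.equiv (Fin 3) ℝ) u) ((EuclideanSpace.equiv (Fin 3) ℝ) v))

/-- The inner product on `EuclideanSpace ℝ (Fin 3)` in coordinates. -/
theorem inner_eq_three (u v : EuclideanSpace ℝ (Fin 3)) :
    ⟪u, v⟫ = u 0 * v 0 + u 1 * v 1 + u 2 * v 2 := by
  simp [PiLp.inner_apply, Fin.sum_univ_three, mul_comm]

theorem cross3_zero (u v : EuclideanSpace ℝ (Fin 3)) :
    cross3 u v 0 = u 1 * v 2 - u 2 * v 1 := by
  simp [cross3, cross_apply]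

theorem cross3_one (u v : EuclideanSpace ℝ (Fin 3)) :
    cross3 u v 1 = u 2 * v 0 - u 0 * v 2 := by
  simp [cross3, cross_apply]

theorem cross3_two (u v : EuclideanSpace ℝ (Fin 3)) :
    cross3 u v 2 = u 0 * v 1 - u 1 * v 0 := by
  simp [cross3, cross_apply]

theorem inner_left_cross3 (u v : EuclideanSpace ℝ (Fin 3)) : ⟪u, cross3 u v⟫ = 0 := by
  simp only [inner_eq_three, cross3_zero, cross3_one, cross3_two]
  ring

theorem inner_right_cross3 (u v : EuclideanSpace ℝ (Fin 3)) : ⟪v, cross3 u v⟫ = 0 := by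
  simp only [inner_eq_three, cross3_zero, cross3_one, cross3_two]
  ring

theorem inner_cross3_self (u v : EuclideanSpace ℝ (Fin 3)) :
    ⟪cross3 u v, cross3 u v⟫ = ⟪u, u⟫ * ⟪v, v⟫ - ⟪u, v⟫ ^ 2 := by
  simp only [inner_eq_three, cross3_zero, cross3_one, cross3_two]
  ring

theorem ContDiff.cross3 {n : WithTop ℕ∞} {u v : ℝ → EuclideanSpace ℝ (Fin 3)}
    (hu : ContDiff ℝ n u) (hv : ContDiff ℝ n v) :
    ContDiff ℝ n fun s => cross3 (u s) (v s) := by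
  rw [contDiff_euclidean] at hu hv ⊢
  intro i
  fin_cases i
  · simpa [cross3_zero] using ((hu 1).mul (hv 2)).sub ((hu 2).mul (hv 1))
  · simpa [cross3_one] using ((hu 2).mul (hv 0)).sub ((hu 0).mul (hv 2))
  · simpa [cross3_two] using ((hu 0).mul (hv 1)).sub ((hu 1).mul (hv 0))

/-- A vector orthogonal to `u` is expanded in the orthonormal pair `v`, `u × v`. -/
theorem eq_inner_smul_add_inner_cross3_smul {u v w : EuclideanSpace ℝ (Fin 3)}
    (hu : ‖u‖ = 1) (hv : ‖v‖ = 1) (huv : ⟪u, v⟫ = 0) (huw : ⟪u, w⟫ = 0) :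
    w = ⟪v, w⟫ • v + ⟪cross3 u v, w⟫ • cross3 u v := by
  have hb : ‖cross3 u v‖ = 1 := by
    have h := inner_cross3_self u v
    simp only [real_inner_self_eq_norm_sq, hu, hv, huv] at h
    have h0 := norm_nonneg (cross3 u v)
    nlinarith
  have hon : Orthonormal ℝ ![u, v, cross3 u v] := by
    refine ⟨fun i => by fin_cases i <;> simp [hu, hv, hb], fun i j hij => ?_⟩
    have h1 := inner_left_cross3 u v
    have h2 := inner_right_cross3 u v
    fin_cases i <;> fin_cases j <;>
      simp_all [real_inner_comm]
  let b := OrthonormalBasis.mk hon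
    (hon.linearIndependent.span_eq_top_of_card_eq_finrank (by simp)).ge
  have h := b.sum_repr' w
  simpa [b, Fin.sum_univ_three, huw] using h.symm

/-- If two differentiable curves stay orthogonal, differentiation can be moved across the
inner product at the cost of a sign. -/
theorem inner_deriv_eq_neg_of_inner_eq_zero {E : Type*} [NormedAddCommGroup E]
    [InnerProductSpace ℝ E] {u v : ℝ → E} (hu : Differentiable ℝ u) (hv : Differentiable ℝ v)
    (h : ∀ s, ⟪u s, v s⟫ = 0) (s : ℝ) :
    ⟪deriv u s, v s⟫ = -⟪deriv v s, u s⟫ := by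
  have h1 := (hu s).hasDerivAt.inner ℝ (hv s).hasDerivAt
  have h2 : (fun t => ⟪u t, v t⟫) = fun _ => 0 := funext h
  rw [h2] at h1
  have h3 := h1.unique (hasDerivAt_const s (0 : ℝ))
  rw [real_inner_comm (u s) (deriv v s)]
  linarith

/-- A nowhere vanishing continuous real function has constant sign. -/
theorem exists_sign_mul_abs {f : ℝ → ℝ} (hf : Continuous f) (h0 : ∀ s, f s ≠ 0) :
    ∃ ε : ℝ, (ε = 1 ∨ ε = -1) ∧ ∀ s, f s = ε * |f s| := by
  have key : (∀ s, 0 < f s) ∨ ∀ s, f s < 0 := by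
    by_contra! hc
    obtain ⟨⟨x, hx⟩, y, hy⟩ := hc
    obtain ⟨z, hz⟩ := mem_range_of_exists_le_of_exists_ge hf ⟨x, hx⟩ ⟨y, hy⟩
    exact h0 z hz
  rcases key with h | h
  · exact ⟨1, Or.inl rfl, fun s => by rw [abs_of_pos (h s), one_mul]⟩
  · exact ⟨-1, Or.inr rfl, fun s => by rw [abs_of_neg (h s)]; ring⟩

theorem stmt10
    (α N : ℝ → EuclideanSpace ℝ (Fin 3))
    (hα : ContDiff ℝ (⊤ : ℕ∞) α) (hN : ContDiff ℝ (⊤ : ℕ∞) N)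
    (hunit : ∀ s, ‖deriv α s‖ = 1)
    (hNunit : ∀ s, ‖N s‖ = 1)
    (hNT : ∀ s, ⟪N s, deriv α s⟫ = 0)
    (T B : ℝ → EuclideanSpace ℝ (Fin 3))
    (hT : ∀ s, T s = deriv α s)
    (hB : ∀ s, B s = cross3 (N s) (T s))
    (kn kg τg : ℝ → ℝ)
    (hkn : ∀ s, kn s = ⟪deriv T s, N s⟫)
    (hkg : ∀ s, kg s = ⟪deriv T s, B s⟫)
    (hτg : ∀ s, τg s = ⟪deriv B s, N s⟫)
    (d : EuclideanSpace ℝ (Fin 3)) (hd : ‖d‖ = 1)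
    (hsil : ∀ s, ⟪N s, d⟫ = 0)
    (hpos : ∀ s, 0 < kn s ^ 2 + τg s ^ 2) :
    (∃ ε : ℝ, (ε = 1 ∨ ε = -1) ∧
      ∀ s, Real.sqrt (kn s ^ 2 + τg s ^ 2) • d = ε • (τg s • T s - kn s • B s)) ∧
      ∀ s, ∃ a c : ℝ, d = a • T s + c • B s := by
  have hTα : T = deriv α := funext hT
  have hBc : B = fun s => cross3 (N s) (T s) := funext hB
  have hTs : ContDiff ℝ (⊤ : ℕ∞) T := hTα ▸ (contDiff_infty_iff_deriv.1 hα).2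
  have hBs : ContDiff ℝ (⊤ : ℕ∞) B := hBc ▸ hN.cross3 hTs
  have hTd := contDiff_infty_iff_deriv.1 hTs
  have hBd := contDiff_infty_iff_deriv.1 hBs
  have hNd := contDiff_infty_iff_deriv.1 hN
  have hT1 : ∀ s, ‖T s‖ = 1 := fun s => by rw [hT, hunit]
  have hNT0 : ∀ s, ⟪N s, T s⟫ = 0 := fun s => by rw [hT, hNT]
  have hNB0 : ∀ s, ⟪N s, B s⟫ = 0 := fun s => by rw [hB, inner_left_cross3]
  have hexp : ∀ s, d = ⟪T s, d⟫ • T s + ⟪B s, d⟫ • B s := fun s => by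
    rw [hB]
    exact eq_inner_smul_add_inner_cross3_smul (hNunit s) (hT1 s) (hNT0 s) (hsil s)
  refine ⟨?_, fun s => ⟨_, _, hexp s⟩⟩
  have hsq : ∀ s, ⟪T s, d⟫ ^ 2 + ⟪B s, d⟫ ^ 2 = 1 := fun s => by
    have h := congrArg (fun v => ⟪v, d⟫) (hexp s)
    simp only [inner_add_left, real_inner_smul_left, real_inner_self_eq_norm_sq, hd] at h
    linarith
  have hlin : ∀ s, kn s * ⟪T s, d⟫ + τg s * ⟪B s, d⟫ = 0 := fun s => by
    have h1 := inner_deriv_eq_neg_of_inner_eq_zero hNd.1 hTd.1 hNT0 s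
    have h2 := inner_deriv_eq_neg_of_inner_eq_zero hNd.1 hBd.1 hNB0 s
    have h3 := inner_deriv_eq_neg_of_inner_eq_zero hNd.1 (differentiable_const d) hsil s
    rw [hexp s, inner_add_right, real_inner_smul_right, real_inner_smul_right, h1, h2,
      ← hexp s, ← hkn, ← hτg] at h3
    simp only [deriv_const, inner_zero_left] at h3
    linarith
  have hknc : Continuous kn := by
    rw [funext hkn]
    exact hTd.2.continuous.inner hN.continuous
  have hτgc : Continuous τg := by
    rw [funext hτg]
    exact hBd.2.continuous.inner hN.continuous
  let f : ℝ → ℝ := fun s => τg s * ⟪T s, d⟫ - kn s * ⟪B s, d⟫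
  have hfc : Continuous f :=
    (hτgc.mul (hTs.continuous.inner continuous_const)).sub
      (hknc.mul (hBs.continuous.inner continuous_const))
  have hf2 : ∀ s, f s ^ 2 = kn s ^ 2 + τg s ^ 2 := fun s => by
    simp only [f]
    linear_combination (kn s ^ 2 + τg s ^ 2) * hsq s -
      (kn s * ⟪T s, d⟫ + τg s * ⟪B s, d⟫) * hlin s
  have hf0 : ∀ s, f s ≠ 0 := fun s h => by
    have := hpos s
    rw [← hf2, h] at this
    simp at this
  obtain ⟨ε, hε, hfε⟩ := exists_sign_mul_abs hfc hf0
  refine ⟨ε, hε, fun s => ?_⟩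
  have hεε : ε * ε = 1 := by rcases hε with rfl | rfl <;> norm_num
  have hr : √(kn s ^ 2 + τg s ^ 2) = ε * f s := by
    rw [← hf2, Real.sqrt_sq_eq_abs]
    linear_combination (-ε) * hfε s - |f s| * hεε
  have hTc : f s * ⟪T s, d⟫ = τg s := by
    simp only [f]
    linear_combination τg s * hsq s - ⟪B s, d⟫ * hlin s
  have hBc' : f s * ⟪B s, d⟫ = -kn s := by
    simp only [f]
    linear_combination (-kn s) * hsq s + ⟪T s, d⟫ * hlin s
  rw [hr, mul_smul]
  congr 1
  conv_lhs => rw [hexp s]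
  rw [smul_add, smul_smul, smul_smul, hTc, hBc', neg_smul, sub_eq_add_neg]
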